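/- Let α > n, 0 < p < 2(n−1)/(n+α−2), 0 < t < 2n/(n+α), θ = 1/(p−1), κ = t′−1, s₁ = n+α−2−(n−α)/(p−1), s₂ = (α−n)t′+2n, and let (u, v) be a pair of positive Lebesgue measurable solutions (with the integrability normalization of the paper) of the system u(y) = ∫_{ℝ^n_+} v^κ(x) |x−y|^{α−n} |x−x^o|^{−s₂} dx for y ∈ ∂ℝ^n_+ and v(x) = ∫_{∂ℝ^n_+} u^θ(y) |x−y|^{α−n} |y−x^o|^{−s₁} dy for x ∈ ℝ^n_+. Then u and v are symmetric with respect to the x_n-axis: u(y) depends only on |y| for y ∈ ∂ℝ^n_+ ≅ ℝ^{n−1}, and v(x′, x_n) depends only on (|x′|, x_n). -/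

import Mathlib

noncomputable section

open MeasureTheory Metric ENNReal

/-- `ℝ^n` with the Euclidean norm. -/
abbrev Eu (n : ℕ) : Type := EuclideanSpace ℝ (Fin n)

/-- The last coordinate `x_n` of a point `x ∈ ℝ^n`. -/
def lastCoord (n : ℕ) (x : Eu n) : ℝ :=
  if h : 0 < n then x ⟨n - 1, Nat.sub_lt h Nat.one_pos⟩ else 0

/-- The first coordinate `x_1` of a point `x ∈ ℝ^n`. -/
def firstCoord (n : ℕ) (x : Eu n) : ℝ :=
  if h : 0 < n then x ⟨0, h⟩ else 0

/-- The open upper half space `ℝ^n_+ = {x : x_n > 0}`. -/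
def upperHalf (n : ℕ) : Set (Eu n) := {x | 0 < lastCoord n x}

/-- The identification of `ℝ^{n-1}` with the boundary `∂ℝ^n_+ = {x : x_n = 0}`. -/
def emb (n : ℕ) (y : Eu (n - 1)) : Eu n :=
  (EuclideanSpace.equiv (Fin n) ℝ).symm fun i =>
    if h : (i : ℕ) < n - 1 then y ⟨i, h⟩ else 0

/-- The point `z^o = (0,…,0,-1) ∈ ℝ^n`. -/
def zo (n : ℕ) : Eu n :=
  (EuclideanSpace.equiv (Fin n) ℝ).symm fun i => if (i : ℕ) = n - 1 then -1 else 0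

/-- The point `x^o = (0,…,0,-2) ∈ ℝ^n`. -/
def xo (n : ℕ) : Eu n :=
  (EuclideanSpace.equiv (Fin n) ℝ).symm fun i => if (i : ℕ) = n - 1 then -2 else 0

/-- The surface measure on the sphere `∂B^n = {x : |x - z^o| = 1}`. -/
def surf (n : ℕ) : Measure (Eu n) :=
  Measure.map (fun p : sphere (0 : Eu n) 1 => zo n + (p : Eu n))
    (volume : Measure (Eu n)).toSphere

/-- Lebesgue measure restricted to the open unit ball `B^n` centered at `z^o`. -/
def ballM (n : ℕ) : Measure (Eu n) := (volume : Measure (Eu n)).restrict (ball (zo n) 1)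

/-- `ω_n`, the volume of the unit ball in `ℝ^n`. -/
def unitBallVol (n : ℕ) : ℝ := ((volume : Measure (Eu n)) (ball (0 : Eu n) 1)).toReal

/-- `(∫ F^r)^{1/r}` (in `ℝ≥0∞`) of a nonnegative function `F`, for an arbitrary
nonzero real exponent `r`. -/
def eLp {X : Type*} [MeasurableSpace X] (μ : Measure X) (f : X → ℝ) (r : ℝ) : ℝ≥0∞ :=
  (∫⁻ x, ENNReal.ofReal (f x) ^ r ∂μ) ^ (1 / r)

/-- `(∫ F^r)^{1/r}` (in `ℝ≥0∞`) of an `ℝ≥0∞`-valued function `F`. -/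
def eLpE {X : Type*} [MeasurableSpace X] (μ : Measure X) (F : X → ℝ≥0∞) (r : ℝ) : ℝ≥0∞ :=
  (∫⁻ x, F x ^ r ∂μ) ^ (1 / r)

/-- The real `L^r`-norm `(∫ |f|^r)^{1/r}`. -/
def rLp {X : Type*} [MeasurableSpace X] (μ : Measure X) (f : X → ℝ) (r : ℝ) : ℝ :=
  (∫ x, |f x| ^ r ∂μ) ^ (1 / r)

/-- The sharp constant `C_{e1}(n,α)`. -/
def Ce1 (n : ℕ) (α : ℝ) : ℝ :=
  ((n : ℝ) * unitBallVol n) ^ (-(((n : ℝ) + α - 2) / (2 * ((n : ℝ) - 1)))) *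
    (∫ ξ in ball (zo n) 1,
        (∫ ζ, ‖ξ - ζ‖ ^ (α - (n : ℝ)) ∂surf n) ^ (2 * (n : ℝ) / ((n : ℝ) - α))) ^
      (((n : ℝ) - α) / (2 * (n : ℝ)))

/-- The sharp constant `C_{e2}(n,α)`. -/
def Ce2 (n : ℕ) (α : ℝ) : ℝ :=
  ((n : ℝ) * unitBallVol n) ^ (-(((n : ℝ) + α - 4) / (2 * ((n : ℝ) - 1)))) *
    (∫ ξ in ball (zo n) 1,
        (∫ ζ, (1 - ‖ξ - zo n‖ ^ 2) * ‖ξ - ζ‖ ^ (-((n : ℝ) - α + 2)) ∂surf n) ^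
          (2 * (n : ℝ) / ((n : ℝ) - α))) ^ (((n : ℝ) - α) / (2 * (n : ℝ)))


section MovingPlanes

set_option linter.unusedSectionVars false

open Filter Topology Set

variable {E : Type*} [NormedAddCommGroup E] [InnerProductSpace ℝ E]

/-- Reflection across the hyperplane `⟪e, x⟫ = l`. -/
def Rf (e : E) (l : ℝ) (x : E) : E := x + (2 * (l - inner ℝ e x)) • e

lemma Rf_inner {e : E} (he : ‖e‖ = 1) (l : ℝ) (x : E) :
    inner ℝ e (Rf e l x) = 2 * l - inner ℝ e x := by
  have h : inner ℝ e e = (1 : ℝ) := by rw [real_inner_self_eq_norm_sq, he]; norm_num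
  simp only [Rf, inner_add_right, real_inner_smul_right, h]; ring

lemma Rf_Rf {e : E} (he : ‖e‖ = 1) (l : ℝ) (x : E) : Rf e l (Rf e l x) = x := by
  have h := Rf_inner he l x
  conv_lhs => rw [Rf]
  rw [h, Rf, add_assoc, ← add_smul]
  have : (2 * (l - inner ℝ e x) + 2 * (l - (2 * l - inner ℝ e x))) = 0 := by ring
  rw [this]; simp

lemma Rf_sq {e : E} (he : ‖e‖ = 1) (l : ℝ) (x z : E) :
    ‖Rf e l x - z‖ ^ 2 = ‖x - z‖ ^ 2 + 4 * (l - inner ℝ e x) * (l - inner ℝ e z) := by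
  have h : Rf e l x - z = (x - z) + (2 * (l - inner ℝ e x)) • e := by rw [Rf]; abel
  rw [h, norm_add_sq_real, real_inner_smul_right, norm_smul, he, real_inner_comm e (x - z), inner_sub_right,
    Real.norm_eq_abs, mul_one, sq_abs]
  ring

lemma Rf_norm_comm {e : E} (he : ‖e‖ = 1) (l : ℝ) (x z : E) :
    ‖x - Rf e l z‖ = ‖Rf e l x - z‖ := by
  have h1 := Rf_sq he l x z
  have h2 := Rf_sq he l z x
  rw [norm_sub_rev x]
  rw [norm_sub_rev x z] at h1
  have : ‖Rf e l z - x‖ ^ 2 = ‖Rf e l x - z‖ ^ 2 := by rw [h1, h2]; ring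
  exact (sq_eq_sq₀ (norm_nonneg _) (norm_nonneg _)).1 this

lemma Rf_norm_Rf {e : E} (he : ‖e‖ = 1) (l : ℝ) (x z : E) :
    ‖Rf e l x - Rf e l z‖ = ‖x - z‖ := by
  rw [Rf_norm_comm he, Rf_Rf he]

lemma Rf_lt {e : E} (he : ‖e‖ = 1) {l : ℝ} {x z : E} (hx : l < inner ℝ e x)
    (hz : inner ℝ e z < l) : ‖Rf e l x - z‖ < ‖x - z‖ := by
  have h1 := Rf_sq he l x z
  refine lt_of_pow_lt_pow_left₀ 2 (norm_nonneg _) ?_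
  nlinarith [mul_pos (sub_pos.2 hx) (sub_pos.2 hz)]

lemma Rf_gt {e : E} (he : ‖e‖ = 1) {l : ℝ} {x z : E} (hx : l < inner ℝ e x)
    (hz : l < inner ℝ e z) : ‖x - z‖ < ‖Rf e l x - z‖ := by
  have h1 := Rf_sq he l x z
  refine lt_of_pow_lt_pow_left₀ 2 (norm_nonneg _) ?_
  nlinarith [mul_pos (sub_pos.2 hx) (sub_pos.2 hz)]

lemma Rf_norm_le {e : E} (he : ‖e‖ = 1) {l : ℝ} (hl : 0 < l) {x : E} (hx : l < inner ℝ e x) :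
    ‖Rf e l x‖ ≤ ‖x‖ := by
  have := Rf_lt he hx (z := 0) (by simpa using hl)
  simpa using this.le

lemma Rf_continuous (e : E) (l : ℝ) : Continuous (Rf e l) := by
  unfold Rf; fun_prop

lemma Rf_continuous_l (e x : E) : Continuous (fun l => Rf e l x) := by
  unfold Rf; fun_prop

def RfHomeo {e : E} (he : ‖e‖ = 1) (l : ℝ) : E ≃ₜ E where
  toFun := Rf e l
  invFun := Rf e l
  left_inv := Rf_Rf he l
  right_inv := Rf_Rf he l
  continuous_toFun := Rf_continuous e l
  continuous_invFun := Rf_continuous e l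

lemma rpow_convex_neg {k s t : ℝ} (hk : k < 0) (hs : 0 < s) (ht : 0 < t) :
    s ^ k - t ^ k ≤ (-k) * s ^ (k - 1) * (t - s) := by
  obtain ⟨z, hz, rfl⟩ : ∃ z, 0 < z ∧ t = s * z := ⟨t / s, by positivity, by field_simp⟩
  rw [Real.mul_rpow hs.le hz.le, Real.rpow_sub_one hs.ne']
  have h1 : 1 + k * (z - 1) ≤ z ^ k := by
    rw [Real.rpow_def_of_pos hz]
    have := Real.add_one_le_exp (Real.log z * k)
    have := Real.log_le_sub_one_of_pos hz
    nlinarith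
  have hp := Real.rpow_pos_of_pos hs k
  have : -k * (s ^ k / s) * (s * z - s) = s ^ k * (-k * (z - 1)) := by field_simp
  rw [this]
  nlinarith

variable [MeasurableSpace E] [BorelSpace E]

/-- One half of the system. -/
structure Half (e : E) (b : ℝ) (μ : Measure E) (w : E → ℝ) (k : ℝ) (v u : E → ℝ) : Prop where
  he : ‖e‖ = 1
  hb : 0 < b
  hk : k < 0
  inv : ∀ l, MeasurePreserving (Rf e l) μ μ
  null : ∀ l, μ {x | inner ℝ e x = l} = 0
  pos : ∀ l, μ {x | l < inner ℝ e x} ≠ 0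
  wm : Measurable w
  w0 : ∀ x, 0 ≤ w x
  wpos : ∀ᵐ x ∂μ, 0 < w x
  wlt : ∀ l, 0 < l → ∀ᵐ x ∂μ, l < inner ℝ e x → w x < w (Rf e l x)
  vm : Measurable v
  v0 : ∀ x, 0 < v x
  int : Integrable (fun x => v x ^ k * w x * (1 + ‖x‖) ^ b) μ
  rep : ∀ y, u y = ∫ x, v x ^ k * w x * ‖x - y‖ ^ b ∂μ

namespace Half

variable {e : E} {b : ℝ} {μ : Measure E} {w : E → ℝ} {k : ℝ} {v u : E → ℝ}

lemma norm_le (x y : E) : ‖x - y‖ ≤ (1 + ‖x‖) * (1 + ‖y‖) := by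
  have := norm_sub_le x y
  nlinarith [norm_nonneg x, norm_nonneg y, mul_nonneg (norm_nonneg x) (norm_nonneg y)]

lemma rpow_norm_le {b : ℝ} (hb : 0 < b) (x y : E) :
    ‖x - y‖ ^ b ≤ (1 + ‖x‖) ^ b * (1 + ‖y‖) ^ b := by
  rw [← Real.mul_rpow (by positivity) (by positivity)]
  exact Real.rpow_le_rpow (norm_nonneg _) (norm_le x y) hb.le

lemma g0 (h : Half e b μ w k v u) (x : E) : 0 ≤ v x ^ k * w x :=
  mul_nonneg (Real.rpow_nonneg (h.v0 x).le _) (h.w0 x)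

lemma gm (h : Half e b μ w k v u) : Measurable (fun x => v x ^ k * w x) :=
  (h.vm.pow_const k).mul h.wm

lemma _root_.int_gen {g : E → ℝ} (hg : ∀ x, 0 ≤ g x) (hgm : Measurable g) {b : ℝ} (hb : 0 < b)
    (hi : Integrable (fun x => g x * (1 + ‖x‖) ^ b) μ) (y : E) :
    Integrable (fun x => g x * ‖x - y‖ ^ b) μ := by
  refine (hi.mul_const ((1 + ‖y‖) ^ b)).mono' ?_ ?_
  · have : Measurable (fun x : E => ‖x - y‖ ^ b) :=
      (Continuous.rpow_const (by fun_prop) (fun _ => Or.inr hb.le)).measurable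
    exact (hgm.mul this).aestronglyMeasurable
  · refine Eventually.of_forall fun x => ?_
    have h0 := hg x
    rw [Real.norm_of_nonneg (by positivity), mul_assoc]
    exact mul_le_mul_of_nonneg_left (rpow_norm_le hb x y) h0

lemma _root_.cont_gen {g : E → ℝ} (hg : ∀ x, 0 ≤ g x) (hgm : Measurable g) {b : ℝ} (hb : 0 < b)
    (hi : Integrable (fun x => g x * (1 + ‖x‖) ^ b) μ) :
    Continuous (fun y => ∫ x, g x * ‖x - y‖ ^ b ∂μ) := by
  refine continuous_iff_continuousAt.2 fun y0 => ?_
  refine continuousAt_of_dominated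
    (bound := fun x => g x * (1 + ‖x‖) ^ b * (1 + (‖y0‖ + 1)) ^ b)
    (Eventually.of_forall fun y => (int_gen hg hgm hb hi y).aestronglyMeasurable) ?_
    (hi.mul_const _) ?_
  · have : ∀ᶠ y in 𝓝 y0, ‖y‖ < ‖y0‖ + 1 :=
      continuous_norm.continuousAt.eventually_lt continuousAt_const (by simp)
    filter_upwards [this] with y hy
    refine Eventually.of_forall fun x => ?_
    have h0 := hg x
    rw [Real.norm_of_nonneg (by positivity), mul_assoc (g x)]
    refine mul_le_mul_of_nonneg_left ((rpow_norm_le hb x y).trans ?_) h0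
    have := hb.le
    gcongr
  · refine Eventually.of_forall fun x => ?_
    have : Continuous fun y => g x * ‖x - y‖ ^ b :=
      continuous_const.mul (Continuous.rpow_const (by fun_prop) (fun _ => Or.inr hb.le))
    exact this.continuousAt

lemma int_y (h : Half e b μ w k v u) (y : E) :
    Integrable (fun x => v x ^ k * w x * ‖x - y‖ ^ b) μ :=
  int_gen h.g0 h.gm h.hb h.int y

lemma upper (h : Half e b μ w k v u) (y : E) :
    u y ≤ (∫ x, v x ^ k * w x * (1 + ‖x‖) ^ b ∂μ) * (1 + ‖y‖) ^ b := by
  rw [h.rep, ← integral_mul_const]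
  refine integral_mono (h.int_y y) (h.int.mul_const _) fun x => ?_
  have := mul_le_mul_of_nonneg_left (rpow_norm_le h.hb x y) (h.g0 x)
  simpa [mul_assoc] using this

lemma cont (h : Half e b μ w k v u) : Continuous u := by
  have : u = fun y => ∫ x, v x ^ k * w x * ‖x - y‖ ^ b ∂μ := funext h.rep
  rw [this]
  exact cont_gen h.g0 h.gm h.hb h.int

lemma meas_Sig (e : E) (l : ℝ) : MeasurableSet {x : E | l < inner ℝ e x} :=
  (isOpen_lt continuous_const (by fun_prop)).measurableSet

lemma meas_Sig' (e : E) (l : ℝ) : MeasurableSet {x : E | inner ℝ e x < l} :=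
  (isOpen_lt (by fun_prop) continuous_const).measurableSet

lemma emb_Rf (he : ‖e‖ = 1) (l : ℝ) : MeasurableEmbedding (Rf e l) :=
  (RfHomeo he l).measurableEmbedding

lemma pos' (h : Half e b μ w k v u) (l : ℝ) : μ {x | inner ℝ e x < l} ≠ 0 := by
  have h1 := h.pos l
  rw [← (h.inv l).measure_preimage_emb (emb_Rf h.he l)] at h1
  have : Rf e l ⁻¹' {x | l < inner ℝ e x} = {x | inner ℝ e x < l} := by
    ext x
    simp only [mem_preimage, mem_ofPred_eq, Rf_inner h.he]
    constructor <;> intro h <;> linarith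
  rwa [this] at h1

/-- positivity of set integrals -/
lemma setInt_pos {f : E → ℝ} {s : Set E} (hs : MeasurableSet s) (hμ : μ s ≠ 0)
    (hf : IntegrableOn f s μ) (hp : ∀ᵐ x ∂μ, x ∈ s → 0 < f x) : 0 < ∫ x in s, f x ∂μ := by
  have hp' : ∀ᵐ x ∂(μ.restrict s), 0 < f x := (ae_restrict_iff' hs).2 hp
  rw [integral_pos_iff_support_of_nonneg_ae (hp'.mono fun x hx => hx.le) hf]
  have : (Function.support f) =ᵐ[μ.restrict s] (univ : Set E) := by
    refine eventuallyEq_univ.2 ?_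
    filter_upwards [hp'] with x hx using hx.ne'
  rw [measure_congr this]
  simpa [pos_iff_ne_zero] using hμ

lemma lower (h : Half e b μ w k v u) : ∃ c, 0 < c ∧ ∀ y, c * (1 + ‖y‖) ^ b ≤ u y := by
  have hIw : Integrable (fun x => v x ^ k * w x * (2 + ‖x‖) ^ (-b)) μ := by
    refine h.int.mono' ?_ ?_
    · have : Measurable (fun x : E => (2 + ‖x‖) ^ (-b)) := by fun_prop
      exact (h.gm.mul this).aestronglyMeasurable
    · refine Eventually.of_forall fun x => ?_
      have h0 := h.g0 x
      rw [Real.norm_of_nonneg (by positivity)]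
      refine mul_le_mul_of_nonneg_left ?_ h0
      calc (2 + ‖x‖) ^ (-b) ≤ 1 := Real.rpow_le_one_of_one_le_of_nonpos
            (by linarith [norm_nonneg x]) (by linarith [h.hb])
        _ ≤ _ := Real.one_le_rpow (by linarith [norm_nonneg x]) h.hb.le
  have hpp : ∀ᵐ x ∂μ, 0 < v x ^ k * w x * (2 + ‖x‖) ^ (-b) := by
    filter_upwards [h.wpos] with x hx
    have := Real.rpow_pos_of_pos (h.v0 x) k
    positivity
  have c1 := setInt_pos (meas_Sig e 1) (h.pos 1) hIw.integrableOn (hpp.mono fun x hx _ => hx)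
  have c2 := setInt_pos (meas_Sig' e (-1)) (h.pos' (-1)) hIw.integrableOn
    (hpp.mono fun x hx _ => hx)
  have key : ∀ y : E, ∀ s : Set E, MeasurableSet s → (∀ x ∈ s, 1 ≤ ‖x - y‖) →
      (∫ x in s, v x ^ k * w x * (2 + ‖x‖) ^ (-b) ∂μ) * (1 + ‖y‖) ^ b ≤ u y := by
    intro y s hs hsy
    rw [h.rep y, ← integral_mul_const]
    refine le_trans ?_ (setIntegral_le_integral (s := s) (h.int_y y) (Eventually.of_forall fun x => by
      have := h.g0 x
      simp only [Pi.zero_apply]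
      positivity))
    refine setIntegral_mono_on (hIw.mul_const _).integrableOn (h.int_y y).integrableOn hs ?_
    intro x hx
    rw [mul_assoc]
    refine mul_le_mul_of_nonneg_left ?_ (h.g0 x)
    have h1 := hsy x hx
    have h2 : 1 + ‖y‖ ≤ (2 + ‖x‖) * ‖x - y‖ := by
      have : ‖y‖ ≤ ‖x‖ + ‖x - y‖ := by
        have := norm_sub_le x (x - y)
        simpa using this
      nlinarith [norm_nonneg x]
    rw [Real.rpow_neg (by positivity), inv_mul_le_iff₀ (by positivity),
      ← Real.mul_rpow (by positivity) (by positivity)]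
    exact Real.rpow_le_rpow (by positivity) h2 h.hb.le
  have hin : ∀ z : E, |inner ℝ e z| ≤ ‖z‖ := fun z => by
    have := abs_real_inner_le_norm e z
    rwa [h.he, one_mul] at this
  refine ⟨min _ _, lt_min c1 c2, fun y => ?_⟩
  rcases le_total (inner ℝ e y) 0 with hy | hy
  · refine le_trans ?_ (key y _ (meas_Sig e 1) ?_)
    · gcongr; exact min_le_left _ _
    · intro x hx
      have := (le_abs_self _).trans (hin (x - y))
      rw [inner_sub_right] at this
      simp only [mem_ofPred_eq] at hx
      linarith
  · refine le_trans ?_ (key y _ (meas_Sig' e (-1)) ?_)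
    · gcongr; exact min_le_right _ _
    · intro x hx
      have := (neg_le_abs _).trans (hin (x - y))
      rw [inner_sub_right] at this
      simp only [mem_ofPred_eq] at hx
      linarith

/-- The density of the half system. -/
def gg (w : E → ℝ) (k : ℝ) (v : E → ℝ) (x : E) : ℝ := v x ^ k * w x

lemma int_diff (h : Half e b μ w k v u) (l : ℝ) (y : E) :
    Integrable (fun x => (gg w k v (Rf e l x) - gg w k v x) *
      (‖Rf e l x - y‖ ^ b - ‖x - y‖ ^ b)) μ ∧
    2 * (u y - u (Rf e l y)) = ∫ x, (gg w k v (Rf e l x) - gg w k v x) *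
      (‖Rf e l x - y‖ ^ b - ‖x - y‖ ^ b) ∂μ := by
  have hE := emb_Rf h.he l
  have i1 : Integrable (fun x => gg w k v x * ‖x - y‖ ^ b) μ := h.int_y y
  have i2 : Integrable (fun x => gg w k v x * ‖x - Rf e l y‖ ^ b) μ := h.int_y (Rf e l y)
  have r1 : u y = ∫ x, gg w k v x * ‖x - y‖ ^ b ∂μ := h.rep y
  have r2 : u (Rf e l y) = ∫ x, gg w k v x * ‖x - Rf e l y‖ ^ b ∂μ := h.rep (Rf e l y)
  have i3 : Integrable (fun x => gg w k v (Rf e l x) * ‖Rf e l x - y‖ ^ b) μ :=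
    ((h.inv l).integrable_comp_emb hE).2 i1
  have r3 : ∫ x, gg w k v (Rf e l x) * ‖Rf e l x - y‖ ^ b ∂μ = u y := by
    rw [r1]
    exact (h.inv l).integral_comp hE (fun x => gg w k v x * ‖x - y‖ ^ b)
  have i4 : Integrable (fun x => gg w k v (Rf e l x) * ‖Rf e l x - Rf e l y‖ ^ b) μ :=
    ((h.inv l).integrable_comp_emb hE).2 i2
  have r4 : ∫ x, gg w k v (Rf e l x) * ‖Rf e l x - Rf e l y‖ ^ b ∂μ = u (Rf e l y) := by
    rw [r2]
    exact (h.inv l).integral_comp hE (fun x => gg w k v x * ‖x - Rf e l y‖ ^ b)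
  simp only [Rf_norm_Rf h.he] at i4 r4
  simp only [Rf_norm_comm h.he] at i2 r2
  have hfun : (fun x => (gg w k v (Rf e l x) - gg w k v x) *
      (‖Rf e l x - y‖ ^ b - ‖x - y‖ ^ b)) = fun x =>
      (gg w k v (Rf e l x) * ‖Rf e l x - y‖ ^ b - gg w k v (Rf e l x) * ‖x - y‖ ^ b) -
      (gg w k v x * ‖Rf e l x - y‖ ^ b - gg w k v x * ‖x - y‖ ^ b) := by
    funext x; ring
  rw [hfun]
  refine ⟨(i3.sub i4).sub (i2.sub i1), ?_⟩
  have e1 := integral_sub (i3.sub i4) (i2.sub i1)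
  have e2 := integral_sub i3 i4
  have e3 := integral_sub i2 i1
  simp only [Pi.sub_apply] at e1
  rw [e1, e2, e3, r3, r4, ← r1, ← r2]
  ring

lemma diff (h : Half e b μ w k v u) (l : ℝ) (y : E) :
    u y - u (Rf e l y) = ∫ x in {x | l < inner ℝ e x}, (gg w k v (Rf e l x) - gg w k v x) *
      (‖Rf e l x - y‖ ^ b - ‖x - y‖ ^ b) ∂μ := by
  obtain ⟨hi, hr⟩ := h.int_diff l y
  set I : E → ℝ := fun x => (gg w k v (Rf e l x) - gg w k v x) *
      (‖Rf e l x - y‖ ^ b - ‖x - y‖ ^ b) with hI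
  have hsymm : ∀ x, I (Rf e l x) = I x := by
    intro x
    simp only [hI, Rf_Rf h.he]
    ring
  have h1 := integral_add_compl (meas_Sig e l) hi
  have h2 : ∫ x in {x | l < inner ℝ e x}ᶜ, I x ∂μ = ∫ x in {x | l < inner ℝ e x}, I x ∂μ := by
    rw [← (h.inv l).setIntegral_preimage_emb (emb_Rf h.he l)]
    simp only [hsymm]
    refine setIntegral_congr_set ?_
    have hn : ∀ᵐ x ∂μ, inner ℝ e x ≠ l := by
      rw [ae_iff]; simpa using h.null l
    refine Filter.eventuallyEq_set.2 ?_
    filter_upwards [hn] with x hx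
    simp only [mem_preimage, mem_compl_iff, mem_ofPred_eq, Rf_inner h.he, not_lt]
    constructor
    · intro h'
      exact lt_of_le_of_ne (by linarith) (Ne.symm hx)
    · intro h'
      linarith
  rw [h2, ← hr] at h1
  linarith

lemma ker_pos (h : Half e b μ w k v u) {l : ℝ} {x y : E} (hx : l < inner ℝ e x)
    (hy : l < inner ℝ e y) : 0 < ‖Rf e l x - y‖ ^ b - ‖x - y‖ ^ b :=
  sub_pos.2 (Real.rpow_lt_rpow (norm_nonneg _) (Rf_gt h.he hx hy) h.hb)

lemma strict (h : Half e b μ w k v u) {l : ℝ} (hl : 0 < l)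
    (hv : ∀ x, l < inner ℝ e x → v (Rf e l x) ≤ v x) (y : E) (hy : l < inner ℝ e y) :
    u (Rf e l y) < u y := by
  rw [← sub_pos, h.diff l y]
  refine setInt_pos (meas_Sig e l) (h.pos l) (h.int_diff l y).1.integrableOn ?_
  filter_upwards [h.wlt l hl] with x hx hxs
  refine mul_pos ?_ (h.ker_pos hxs hy)
  have h1 := hx hxs
  have h2 : v x ^ k ≤ v (Rf e l x) ^ k :=
    Real.rpow_le_rpow_of_nonpos (h.v0 _) (hv x hxs) h.hk.le
  have h3 := Real.rpow_pos_of_pos (h.v0 x) k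
  have h4 := h.w0 x
  unfold gg
  nlinarith

/-- The weight. -/
def GG (b : ℝ) (w : E → ℝ) (k : ℝ) (v : E → ℝ) (x : E) : ℝ :=
  -k * (v x ^ (k - 1) * w x * ((1 + ‖x‖) ^ b * (1 + ‖x‖) ^ b))

lemma GG_nonneg (h : Half e b μ w k v u) (x : E) : 0 ≤ GG b w k v x := by
  have h1 := Real.rpow_pos_of_pos (h.v0 x) (k - 1)
  have h2 := h.w0 x
  have h3 : 0 ≤ -k := by linarith [h.hk]
  unfold GG
  positivity

lemma GG_meas (h : Half e b μ w k v u) : Measurable (GG b w k v) := by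
  have h1 := h.vm.pow_const (k - 1)
  have h2 := h.wm
  have h3 : Measurable (fun x : E => (1 + ‖x‖) ^ b) := by fun_prop
  unfold GG
  exact ((h1.mul h2).mul (h3.mul h3)).const_mul _

lemma GG_int (h : Half e b μ w k v u) {c : ℝ} (hc : 0 < c)
    (hcv : ∀ x, c * (1 + ‖x‖) ^ b ≤ v x) : Integrable (GG b w k v) μ := by
  refine (h.int.const_mul (-k * c⁻¹)).mono' h.GG_meas.aestronglyMeasurable
    (Eventually.of_forall fun x => ?_)
  rw [Real.norm_of_nonneg (h.GG_nonneg x)]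
  unfold GG
  have h1 := h.v0 x
  rw [Real.rpow_sub_one h1.ne', mul_assoc (-k)]
  refine mul_le_mul_of_nonneg_left ?_ (by linarith [h.hk])
  have hg := h.g0 x
  have h3 : 0 < (1 + ‖x‖) ^ b := by positivity
  have h2 : (1 + ‖x‖) ^ b / v x ≤ c⁻¹ := by
    rw [div_le_iff₀ h1, ← div_le_iff₀' (by positivity)]
    simpa [mul_comm] using hcv x
  calc v x ^ k / v x * w x * ((1 + ‖x‖) ^ b * (1 + ‖x‖) ^ b)
      = (v x ^ k * w x * (1 + ‖x‖) ^ b) * ((1 + ‖x‖) ^ b / v x) := by ring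
    _ ≤ (v x ^ k * w x * (1 + ‖x‖) ^ b) * c⁻¹ :=
        mul_le_mul_of_nonneg_left h2 (by positivity)
    _ = _ := by ring

/-- The negative part, normalised by the growth. -/
def nn (e : E) (b l : ℝ) (v : E → ℝ) (x : E) : ℝ :=
  max 0 (v (Rf e l x) - v x) / (1 + ‖x‖) ^ b

lemma nn_nonneg (e : E) (b l : ℝ) (v : E → ℝ) (x : E) : 0 ≤ nn e b l v x := by
  unfold nn
  have := le_max_left 0 (v (Rf e l x) - v x)
  positivity

/-- Integrated bound. -/
lemma bound (h : Half e b μ w k v u) {l : ℝ} (hl : 0 < l)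
    (hi : IntegrableOn (fun x => GG b w k v x * nn e b l v x) {x | l < inner ℝ e x} μ)
    (y : E) (hy : l < inner ℝ e y) :
    nn e b l u y ≤ ∫ x in {x | l < inner ℝ e x}, GG b w k v x * nn e b l v x ∂μ := by
  unfold nn
  rw [div_le_iff₀ (by positivity)]
  refine max_le (mul_nonneg (integral_nonneg fun x => mul_nonneg (h.GG_nonneg x)
    (nn_nonneg _ _ _ _ _)) (by positivity)) ?_
  have hd := h.diff l y
  rw [← neg_sub, hd, ← integral_neg, ← integral_mul_const]
  refine integral_mono_ae (h.int_diff l y).1.integrableOn.neg (hi.mul_const _) ?_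
  refine (ae_restrict_iff' (meas_Sig e l)).2 ?_
  filter_upwards [h.wlt l hl] with x hx hxs
  have h1 := hx hxs
  have hker := h.ker_pos hxs hy
  have hw := h.w0 x
  have hv := h.v0 x
  have hkp := Real.rpow_pos_of_pos hv (k - 1)
  have hk0 : 0 < -k := by linarith [h.hk]
  set M := max 0 (v (Rf e l x) - v x) with hM
  have hM0 : 0 ≤ M := le_max_left _ _
  have hker2 : ‖Rf e l x - y‖ ^ b - ‖x - y‖ ^ b ≤ (1 + ‖x‖) ^ b * (1 + ‖y‖) ^ b := by
    have h2 := rpow_norm_le h.hb (Rf e l x) y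
    have h3 : (1 + ‖Rf e l x‖) ^ b ≤ (1 + ‖x‖) ^ b :=
      Real.rpow_le_rpow (by positivity) (by linarith [Rf_norm_le h.he hl hxs]) h.hb.le
    have h4 : 0 ≤ ‖x - y‖ ^ b := by positivity
    have h5 : (1 + ‖Rf e l x‖) ^ b * (1 + ‖y‖) ^ b ≤ (1 + ‖x‖) ^ b * (1 + ‖y‖) ^ b := by gcongr
    linarith
  have hg : gg w k v x - gg w k v (Rf e l x) ≤ -k * (v x ^ (k - 1) * w x) * M := by
    unfold gg
    have hvR := Real.rpow_pos_of_pos (h.v0 (Rf e l x)) k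
    have a1 : v x ^ k * w x - v (Rf e l x) ^ k * w (Rf e l x) ≤
        w x * (v x ^ k - v (Rf e l x) ^ k) := by nlinarith
    have a2 : v x ^ k - v (Rf e l x) ^ k ≤ -k * v x ^ (k - 1) * M := by
      refine (rpow_convex_neg h.hk hv (h.v0 (Rf e l x))).trans ?_
      exact mul_le_mul_of_nonneg_left (le_max_right _ _) (by positivity)
    calc _ ≤ _ := a1
      _ ≤ w x * (-k * v x ^ (k - 1) * M) := mul_le_mul_of_nonneg_left a2 hw
      _ = _ := by ring
  have hx1 : 0 < (1 + ‖x‖) ^ b := by positivity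
  calc -((gg w k v (Rf e l x) - gg w k v x) * (‖Rf e l x - y‖ ^ b - ‖x - y‖ ^ b))
      = (gg w k v x - gg w k v (Rf e l x)) * (‖Rf e l x - y‖ ^ b - ‖x - y‖ ^ b) := by ring
    _ ≤ (-k * (v x ^ (k - 1) * w x) * M) * (‖Rf e l x - y‖ ^ b - ‖x - y‖ ^ b) :=
        mul_le_mul_of_nonneg_right hg hker.le
    _ ≤ (-k * (v x ^ (k - 1) * w x) * M) * ((1 + ‖x‖) ^ b * (1 + ‖y‖) ^ b) :=
        mul_le_mul_of_nonneg_left hker2 (by positivity)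
    _ = _ := by unfold GG; field_simp

lemma nn_meas {v : E → ℝ} (hv : Continuous v) (e : E) (b l : ℝ) :
    Measurable (nn e b l v) := by
  have h1 : Measurable (fun x => v (Rf e l x) - v x) :=
    ((hv.comp (Rf_continuous e l)).sub hv).measurable
  have h3 : Measurable (fun x : E => (1 + ‖x‖) ^ b) := by fun_prop
  unfold nn
  exact (measurable_const.max h1).div h3

/-- Bound of `nn` by a constant, on the half space. -/
lemma nn_le (h : Half e b μ w k v u) (hu0 : ∀ x, 0 < u x) {l : ℝ} (hl : 0 < l) (y : E)
    (hy : l < inner ℝ e y) :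
    nn e b l u y ≤ ∫ x, v x ^ k * w x * (1 + ‖x‖) ^ b ∂μ := by
  have hC : 0 ≤ ∫ x, v x ^ k * w x * (1 + ‖x‖) ^ b ∂μ :=
    integral_nonneg fun x => by
      have := h.g0 x
      simp only [Pi.zero_apply]
      positivity
  unfold nn
  rw [div_le_iff₀ (by positivity)]
  refine max_le (by positivity) ?_
  have h1 := h.upper (Rf e l y)
  have h3 : (1 + ‖Rf e l y‖) ^ b ≤ (1 + ‖y‖) ^ b :=
    Real.rpow_le_rpow (by positivity) (by linarith [Rf_norm_le h.he hl hy]) h.hb.le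
  have h4 := mul_le_mul_of_nonneg_left h3 hC
  linarith [hu0 y]

end Half

section Main

variable {e : E} {b : ℝ} {μ ν : Measure E} {w₁ w₂ : E → ℝ} {k t : ℝ} {v u : E → ℝ}

/-- The moving plane property. -/
def PP (e : E) (l : ℝ) (v : E → ℝ) : Prop := ∀ x, l < inner ℝ e x → v (Rf e l x) ≤ v x

/-- The bad set. -/
def bad (e : E) (l : ℝ) (v : E → ℝ) : Set E := {x | l < inner ℝ e x ∧ v x < v (Rf e l x)}

lemma bad_meas {v : E → ℝ} (hv : Continuous v) (e : E) (l : ℝ) : MeasurableSet (bad e l v) := by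
  have h1 : IsOpen {x : E | l < inner ℝ e x} := isOpen_lt continuous_const (by fun_prop)
  have h2 : IsOpen {x : E | v x < v (Rf e l x)} := isOpen_lt hv (hv.comp (Rf_continuous e l))
  exact (h1.inter h2).measurableSet

lemma PP_of_nn {b l : ℝ} {v : E → ℝ} (h : ∀ x, l < inner ℝ e x → Half.nn e b l v x ≤ 0) :
    PP e l v := by
  intro x hx
  have h1 := h x hx
  unfold Half.nn at h1
  rw [div_le_iff₀ (by positivity), zero_mul] at h1
  have := le_max_right 0 (v (Rf e l x) - v x)
  linarith

/-- Small mass of the bad set implies the moving plane property. -/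
lemma small (h1 : Half e b μ w₂ k v u) (h2 : Half e b ν w₁ t u v) :
    ∃ M, 0 < M ∧ ∀ l, 0 < l → ∫ x in bad e l v, Half.GG b w₂ k v x ∂μ < M →
      PP e l u ∧ PP e l v := by
  obtain ⟨c1, hc1, hl1⟩ := h1.lower
  obtain ⟨c2, hc2, hl2⟩ := h2.lower
  have iv := h1.GG_int hc2 hl2
  have iu := h2.GG_int hc1 hl1
  set N := ∫ x, Half.GG b w₁ t u x ∂ν with hN
  have hN0 : 0 ≤ N := integral_nonneg fun x => h2.GG_nonneg x
  refine ⟨(N + 1)⁻¹, by positivity, fun l hl hm => ?_⟩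
  have cu := h1.cont
  have cv := h2.cont
  have ibv : IntegrableOn (fun x => Half.GG b w₂ k v x * Half.nn e b l v x)
      {x | l < inner ℝ e x} μ := by
    refine (iv.mul_const (∫ x, u x ^ t * w₁ x * (1 + ‖x‖) ^ b ∂ν)).integrableOn.mono' ?_ ?_
    · exact (h1.GG_meas.mul (Half.nn_meas cv e b l)).aestronglyMeasurable
    · refine (ae_restrict_iff' (Half.meas_Sig e l)).2 (Eventually.of_forall fun x hx => ?_)
      rw [Real.norm_of_nonneg (mul_nonneg (h1.GG_nonneg x) (Half.nn_nonneg _ _ _ _ _))]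
      exact mul_le_mul_of_nonneg_left (h2.nn_le h1.v0 hl x hx) (h1.GG_nonneg x)
  have ibu : IntegrableOn (fun x => Half.GG b w₁ t u x * Half.nn e b l u x)
      {x | l < inner ℝ e x} ν := by
    refine (iu.mul_const (∫ x, v x ^ k * w₂ x * (1 + ‖x‖) ^ b ∂μ)).integrableOn.mono' ?_ ?_
    · exact (h2.GG_meas.mul (Half.nn_meas cu e b l)).aestronglyMeasurable
    · refine (ae_restrict_iff' (Half.meas_Sig e l)).2 (Eventually.of_forall fun x hx => ?_)
      rw [Real.norm_of_nonneg (mul_nonneg (h2.GG_nonneg x) (Half.nn_nonneg _ _ _ _ _))]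
      exact mul_le_mul_of_nonneg_left (h1.nn_le h2.v0 hl x hx) (h2.GG_nonneg x)
  have bu := h1.bound hl ibv
  have bv := h2.bound hl ibu
  set B := ∫ x in {x | l < inner ℝ e x}, Half.GG b w₂ k v x * Half.nn e b l v x ∂μ with hB
  set A := ∫ x in {x | l < inner ℝ e x}, Half.GG b w₁ t u x * Half.nn e b l u x ∂ν with hA
  have hB0 : 0 ≤ B := integral_nonneg fun x =>
    mul_nonneg (h1.GG_nonneg x) (Half.nn_nonneg _ _ _ _ _)
  have hA0 : 0 ≤ A := integral_nonneg fun x =>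
    mul_nonneg (h2.GG_nonneg x) (Half.nn_nonneg _ _ _ _ _)
  have hAB : A ≤ N * B := by
    calc A ≤ ∫ x in {x | l < inner ℝ e x}, Half.GG b w₁ t u x * B ∂ν := by
          refine setIntegral_mono_on ibu (iu.mul_const B).integrableOn (Half.meas_Sig e l) ?_
          intro x hx
          exact mul_le_mul_of_nonneg_left (bu x hx) (h2.GG_nonneg x)
      _ ≤ ∫ x, Half.GG b w₁ t u x * B ∂ν :=
          setIntegral_le_integral (iu.mul_const B) (Eventually.of_forall fun x =>
            mul_nonneg (h2.GG_nonneg x) hB0)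
      _ = N * B := by rw [integral_mul_const]
  set m := ∫ x in bad e l v, Half.GG b w₂ k v x ∂μ with hmd
  have hBA : B ≤ m * A := by
    have hbm := bad_meas cv e l
    have hsub : bad e l v ⊆ {x | l < inner ℝ e x} := fun x hx => hx.1
    have : B = ∫ x in bad e l v, Half.GG b w₂ k v x * Half.nn e b l v x ∂μ := by
      refine setIntegral_eq_of_subset_of_forall_sdiff_eq_zero (Half.meas_Sig e l) hsub ?_
      intro x hx
      have h3 : v (Rf e l x) ≤ v x := by
        by_contra h4
        exact hx.2 ⟨hx.1, not_le.1 h4⟩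
      have : Half.nn e b l v x = 0 := by
        unfold Half.nn
        rw [max_eq_left (by linarith), zero_div]
      rw [this, mul_zero]
    rw [this, hmd, ← integral_mul_const]
    refine setIntegral_mono_on (ibv.mono_set hsub) (iv.mul_const A).integrableOn hbm ?_
    intro x hx
    exact mul_le_mul_of_nonneg_left (bv x hx.1) (h1.GG_nonneg x)
  have hm0 : 0 ≤ m := integral_nonneg fun x => h1.GG_nonneg x
  have hmN : m * N < 1 := by
    have : m * (N + 1) < 1 := by
      rwa [← lt_inv_mul_iff₀' (by positivity), mul_one] 
    nlinarith
  have hBz : B = 0 := by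
    have : m * A ≤ m * (N * B) := mul_le_mul_of_nonneg_left hAB hm0
    nlinarith
  have hAz : A ≤ 0 := by rw [hBz] at hAB; linarith
  exact ⟨PP_of_nn fun x hx => (bu x hx).trans_eq hBz, PP_of_nn fun x hx => (bv x hx).trans hAz⟩

lemma bad_tendsto {l : Filter ℝ} [l.IsCountablyGenerated] {G : E → ℝ} (hG : Integrable G μ)
    (hv : Continuous v) (h : ∀ᵐ x ∂μ, ∀ᶠ s in l, x ∉ bad e s v) :
    Tendsto (fun s => ∫ x in bad e s v, G x ∂μ) l (𝓝 0) := by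
  have h0 : (0 : ℝ) = ∫ x, (0 : ℝ) ∂μ := by simp
  rw [h0]
  have : (fun s => ∫ x in bad e s v, G x ∂μ) = fun s => ∫ x, (bad e s v).indicator G x ∂μ := by
    funext s
    rw [integral_indicator (bad_meas hv e s)]
  rw [this]
  refine tendsto_integral_filter_of_dominated_convergence (fun x => ‖G x‖) ?_ ?_ hG.norm ?_
  · exact Eventually.of_forall fun s => hG.aestronglyMeasurable.indicator (bad_meas hv e s)
  · exact Eventually.of_forall fun s => Eventually.of_forall fun x => norm_indicator_le_norm_self _ _
  · filter_upwards [h] with x hx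
    refine tendsto_const_nhds.congr' ?_
    filter_upwards [hx] with s hs
    rw [indicator_of_notMem hs]

lemma PP_closed {v : E → ℝ} (hv : Continuous v) {S : Set ℝ} (hS : ∀ l ∈ S, PP e l v) {l : ℝ}
    (hl : l ∈ closure S) : PP e l v := by
  intro x hx
  by_contra hcon
  push Not at hcon
  have hc : Continuous fun s => v (Rf e s x) := hv.comp (Rf_continuous_l e x)
  have h1 : ∀ᶠ s in 𝓝 l, v x < v (Rf e s x) :=
    continuousAt_const.eventually_lt hc.continuousAt hcon
  have h2 : ∀ᶠ s in 𝓝 l, s < inner ℝ e x := eventually_lt_nhds hx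
  obtain ⟨s, hs, hsS⟩ := (mem_closure_iff_frequently.1 hl).and_eventually (h1.and h2) |>.exists
  exact absurd (hS s hs x hsS.2) (not_le.2 hsS.1)

theorem moving (h1 : Half e b μ w₂ k v u) (h2 : Half e b ν w₁ t u v) :
    PP e 0 u ∧ PP e 0 v := by
  obtain ⟨M, hM, hsm⟩ := small h1 h2
  obtain ⟨c2, hc2, hl2⟩ := h2.lower
  have iv := h1.GG_int hc2 hl2
  have cu := h1.cont
  have cv := h2.cont
  set S : Set ℝ := {l | 0 < l ∧ PP e l u ∧ PP e l v} with hS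
  have hne : (Ioi (0 : ℝ) ∩ S).Nonempty := by
    have ht : Tendsto (fun s => ∫ x in bad e s v, Half.GG b w₂ k v x ∂μ) atTop (𝓝 0) := by
      refine bad_tendsto iv cv (Eventually.of_forall fun x => ?_)
      filter_upwards [eventually_ge_atTop (inner ℝ e x)] with s hs hb
      exact absurd hb.1 (not_lt.2 hs)
    obtain ⟨l, hl1, hl2⟩ := ((ht.eventually_lt_const hM).and (eventually_gt_atTop 0)).exists
    exact ⟨l, hl2, hl2, hsm l hl2 hl1⟩
  have hopen : IsOpen S := by
    rw [isOpen_iff_mem_nhds]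
    intro l hl
    have hst := h2.strict hl.1 hl.2.1
    have ht : Tendsto (fun s => ∫ x in bad e s v, Half.GG b w₂ k v x ∂μ) (𝓝 l) (𝓝 0) := by
      refine bad_tendsto iv cv ?_
      have hn : ∀ᵐ x ∂μ, inner ℝ e x ≠ l := by
        rw [ae_iff]; simpa using h1.null l
      filter_upwards [hn] with x hx
      rcases lt_or_gt_of_ne hx with hx | hx
      · filter_upwards [eventually_gt_nhds hx] with s hs hb
        exact absurd hb.1 (not_lt.2 hs.le)
      · have hc : Continuous fun s => v (Rf e s x) := cv.comp (Rf_continuous_l e x)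
        filter_upwards [hc.continuousAt.eventually_lt continuousAt_const (hst x hx)] with s hs hb
        exact absurd hb.2 (not_lt.2 hs.le)
    filter_upwards [ht.eventually_lt_const hM, eventually_gt_nhds hl.1] with s hs1 hs2
    exact ⟨hs2, hsm s hs2 hs1⟩
  have hsub : Ioi (0 : ℝ) ⊆ S := by
    refine isPreconnected_Ioi.subset_of_closure_inter_subset hopen hne ?_
    intro l hl
    exact ⟨hl.2, PP_closed cu (fun s hs => hs.2.1) hl.1, PP_closed cv (fun s hs => hs.2.2) hl.1⟩
  have h0 : (0 : ℝ) ∈ closure (Ioi (0 : ℝ)) := by rw [closure_Ioi]; simp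
  exact ⟨PP_closed cu (fun s hs => (hsub hs).2.1) h0, PP_closed cv (fun s hs => (hsub hs).2.2) h0⟩

end Main

end MovingPlanes

section Concrete

open Filter Topology Set

lemma Rf_swap {E : Type*} [NormedAddCommGroup E] [InnerProductSpace ℝ E] {y z : E} (h : ‖y‖ = ‖z‖)
    (hne : y ≠ z) : ‖‖y - z‖⁻¹ • (y - z)‖ = 1 ∧ Rf (‖y - z‖⁻¹ • (y - z)) 0 y = z ∧
      0 < inner ℝ (‖y - z‖⁻¹ • (y - z)) y := by
  have hd : 0 < ‖y - z‖ := norm_pos_iff.2 (sub_ne_zero.2 hne)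
  have h1 : inner ℝ (‖y - z‖⁻¹ • (y - z)) y = ‖y - z‖ / 2 := by
    have h2 := norm_sub_sq_real y z
    rw [real_inner_smul_left, inner_sub_left, real_inner_self_eq_norm_sq, real_inner_comm y z]
    rw [← h] at h2
    field_simp
    linarith
  refine ⟨?_, ?_, ?_⟩
  · rw [norm_smul, norm_inv, norm_norm, inv_mul_cancel₀ hd.ne']
  · rw [Rf, h1, smul_smul]
    have : 2 * (0 - ‖y - z‖ / 2) * ‖y - z‖⁻¹ = -1 := by field_simp; ring
    rw [this]; simp
  · rw [h1]; positivity

section Gen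

variable {F : Type*} [NormedAddCommGroup F] [InnerProductSpace ℝ F] [FiniteDimensional ℝ F]
  [MeasurableSpace F] [BorelSpace F]

lemma Rf_vol {e : F} (he : ‖e‖ = 1) (l : ℝ) : MeasurePreserving (Rf e l) := by
  let L : F ≃ₗᵢ[ℝ] F :=
    { toFun := Rf e 0
      invFun := Rf e 0
      left_inv := Rf_Rf he 0
      right_inv := Rf_Rf he 0
      map_add' := fun x y => by simp only [Rf, inner_add_right]; module
      map_smul' := fun c x => by
        simp only [Rf, real_inner_smul_right, RingHom.id_apply]; module
      norm_map' := fun x => by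
        have := Rf_sq he 0 x 0
        simp only [sub_zero, inner_zero_right, mul_zero, add_zero] at this
        exact (sq_eq_sq₀ (norm_nonneg _) (norm_nonneg _)).1 this }
  have h1 : Rf e l = (fun x => x + (2 * l) • e) ∘ L := by
    funext x
    change Rf e l x = Rf e 0 x + (2 * l) • e
    simp only [Rf]; module
  rw [h1]
  exact (measurePreserving_add_right volume _).comp L.measurePreserving

lemma null_vol {e : F} (he : ‖e‖ = 1) (l : ℝ) : (volume : Measure F) {x | inner ℝ e x = l} = 0 := by
  have hee : inner ℝ e e = (1 : ℝ) := by rw [real_inner_self_eq_norm_sq, he]; norm_num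
  have h0 : (volume : Measure F) (LinearMap.ker (innerSL ℝ e : F →ₗ[ℝ] ℝ) : Set F) = 0 := by
    refine Measure.addHaar_submodule _ _ ?_
    intro h
    have : e ∈ LinearMap.ker (innerSL ℝ e : F →ₗ[ℝ] ℝ) := by rw [h]; trivial
    simp at this
    rw [this] at he
    simp at he
  rw [← measure_preimage_add_right (volume : Measure F) (-(l • e))] at h0
  convert h0 using 2
  ext x
  simp only [mem_setOf_eq, mem_preimage, SetLike.mem_coe, LinearMap.mem_ker, ← sub_eq_add_neg]
  change inner ℝ e x = l ↔ inner ℝ e (x - l • e) = 0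
  rw [inner_sub_right, real_inner_smul_right, hee, mul_one, sub_eq_zero]

lemma int_of_two {μ : Measure F} {g : F → ℝ} (hg : ∀ x, 0 ≤ g x) (hgm : Measurable g) {b : ℝ}
    (hb : 0 < b) {y₁ y₂ : F} (hne : y₁ ≠ y₂)
    (h1 : (∫⁻ x, ENNReal.ofReal (g x * ‖x - y₁‖ ^ b) ∂μ) ≠ ⊤)
    (h2 : (∫⁻ x, ENNReal.ofReal (g x * ‖x - y₂‖ ^ b) ∂μ) ≠ ⊤) :
    Integrable (fun x => g x * (1 + ‖x‖) ^ b) μ := by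
  have key : ∀ y, (∫⁻ x, ENNReal.ofReal (g x * ‖x - y‖ ^ b) ∂μ) ≠ ⊤ →
      Integrable (fun x => g x * ‖x - y‖ ^ b) μ := by
    intro y hy
    have hm : Measurable (fun x : F => ‖x - y‖ ^ b) := by fun_prop
    refine (lintegral_ofReal_ne_top_iff_integrable (hgm.mul hm).aestronglyMeasurable
      (Eventually.of_forall fun x => mul_nonneg (hg x) (by positivity))).1 hy
  have i1 := key y₁ h1
  have i2 := key y₂ h2
  have hd : 0 < ‖y₁ - y₂‖ := norm_pos_iff.2 (sub_ne_zero.2 hne)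
  set K := 1 + (1 + ‖y₁‖) / ‖y₁ - y₂‖ with hK
  have hK0 : 0 < K := by positivity
  refine ((i1.add i2).const_mul ((2 * K) ^ b)).mono' ?_ ?_
  · have hm : Measurable (fun x : F => (1 + ‖x‖) ^ b) := by fun_prop
    exact (hgm.mul hm).aestronglyMeasurable
  · refine Eventually.of_forall fun x => ?_
    rw [Real.norm_of_nonneg (mul_nonneg (hg x) (by positivity))]
    simp only [Pi.add_apply]
    have e1 : (2 * K) ^ b * (g x * ‖x - y₁‖ ^ b + g x * ‖x - y₂‖ ^ b) =
      g x * ((2 * K) ^ b * (‖x - y₁‖ ^ b + ‖x - y₂‖ ^ b)) := by ring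
    rw [e1]
    refine mul_le_mul_of_nonneg_left ?_ (hg x)
    have t1 : ‖x‖ ≤ ‖y₁‖ + ‖x - y₁‖ := by
      have := norm_add_le y₁ (x - y₁)
      simpa using this
    have t2 : ‖y₁ - y₂‖ ≤ ‖x - y₁‖ + ‖x - y₂‖ := by
      have := norm_sub_le (x - y₂) (x - y₁)
      rw [show (x - y₂) - (x - y₁) = y₁ - y₂ by abel] at this
      linarith
    have t3 : 1 + ‖x‖ ≤ K * (‖x - y₁‖ + ‖x - y₂‖) := by
      have : 1 + ‖y₁‖ ≤ (1 + ‖y₁‖) / ‖y₁ - y₂‖ * (‖x - y₁‖ + ‖x - y₂‖) := by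
        rw [div_mul_eq_mul_div, le_div_iff₀ hd]
        exact mul_le_mul_of_nonneg_left t2 (by positivity)
      rw [hK, add_mul, one_mul]
      linarith [norm_nonneg (x - y₂)]
    have t4 : ∀ a c : ℝ, 0 ≤ a → 0 ≤ c → 1 + ‖x‖ ≤ K * (a + c) → a ≤ c →
        (1 + ‖x‖) ^ b ≤ (2 * K) ^ b * c ^ b := by
      intro a c ha hc h hac
      rw [← Real.mul_rpow (by positivity) hc]
      refine Real.rpow_le_rpow (by positivity) ?_ hb.le
      nlinarith
    have p1 : 0 ≤ (2 * K) ^ b * ‖x - y₁‖ ^ b := by positivity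
    have p2 : 0 ≤ (2 * K) ^ b * ‖x - y₂‖ ^ b := by positivity
    rw [mul_add]
    rcases le_total ‖x - y₁‖ ‖x - y₂‖ with h | h
    · have := t4 _ _ (norm_nonneg _) (norm_nonneg _) t3 h
      linarith
    · have := t4 _ _ (norm_nonneg _) (norm_nonneg _) (by rw [add_comm ‖x - y₂‖]; exact t3) h
      linarith

lemma pos_gen {μ : Measure F} {g : F → ℝ} (hg : ∀ x, 0 ≤ g x) (hgp : ∀ᵐ x ∂μ, 0 < g x)
    (hgm : Measurable g) {b : ℝ} (hb : 0 < b)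
    (hi : Integrable (fun x => g x * (1 + ‖x‖) ^ b) μ) (hμ : μ univ ≠ 0)
    (hs : ∀ y, μ {y} = 0) (y : F) : 0 < ∫ x, g x * ‖x - y‖ ^ b ∂μ := by
  rw [← setIntegral_univ]
  have hne : ∀ᵐ x ∂μ, x ≠ y := by rw [ae_iff]; simpa using hs y
  refine Half.setInt_pos MeasurableSet.univ hμ (int_gen hg hgm hb hi y).integrableOn ?_
  filter_upwards [hgp, hne] with x h1 h2 _
  have : 0 < ‖x - y‖ := norm_pos_iff.2 (sub_ne_zero.2 h2)
  positivity

lemma rep_gen {μ : Measure F} {g : F → ℝ} (hg : ∀ x, 0 ≤ g x)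
    (hgm : Measurable g) {b : ℝ} (hb : 0 < b)
    (hi : Integrable (fun x => g x * (1 + ‖x‖) ^ b) μ) (y : F) {c : ℝ} (hc : 0 < c)
    (h : ENNReal.ofReal c = ∫⁻ x, ENNReal.ofReal (g x * ‖x - y‖ ^ b) ∂μ) :
    c = ∫ x, g x * ‖x - y‖ ^ b ∂μ := by
  have h1 := ofReal_integral_eq_lintegral_ofReal (int_gen hg hgm hb hi y)
    (Eventually.of_forall fun x => mul_nonneg (hg x) (by positivity))
  rw [← h1] at h
  have h0 : 0 ≤ ∫ x, g x * ‖x - y‖ ^ b ∂μ :=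
    integral_nonneg fun x => mul_nonneg (hg x) (by positivity)
  exact (ENNReal.ofReal_eq_ofReal_iff hc.le h0).1 h

end Gen

lemma emb_apply (n : ℕ) (y : Eu (n - 1)) (i : Fin n) :
    emb n y i = if h : (i : ℕ) < n - 1 then y ⟨i, h⟩ else 0 := rfl

lemma xo_apply (n : ℕ) (i : Fin n) :
    xo n i = if (i : ℕ) = n - 1 then -2 else 0 := rfl

lemma emb_lin (n : ℕ) (a c : Eu (n - 1)) (r : ℝ) : emb n (a + r • c) = emb n a + r • emb n c := by
  ext i
  simp only [PiLp.add_apply, PiLp.smul_apply, emb_apply]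
  split_ifs <;> simp

lemma emb_inner (n : ℕ) (hn : 2 ≤ n) (a c : Eu (n - 1)) :
    inner ℝ (emb n a) (emb n c) = inner ℝ a c := by
  obtain ⟨m, rfl⟩ : ∃ m, n = m + 1 := ⟨n - 1, by omega⟩
  simp only [PiLp.inner_apply, emb_apply]
  rw [Fin.sum_univ_castSucc]
  simp

lemma emb_norm (n : ℕ) (hn : 2 ≤ n) (a : Eu (n - 1)) : ‖emb n a‖ = ‖a‖ := by
  have := emb_inner n hn a a
  rw [real_inner_self_eq_norm_sq, real_inner_self_eq_norm_sq] at this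
  exact (sq_eq_sq₀ (norm_nonneg _) (norm_nonneg _)).1 this

lemma emb_cont (n : ℕ) : Continuous (emb n) := by
  unfold emb
  refine (EuclideanSpace.equiv (Fin n) ℝ).symm.continuous.comp ?_
  refine continuous_pi fun i => ?_
  split_ifs <;> fun_prop

lemma emb_Rf (n : ℕ) (hn : 2 ≤ n) (e y : Eu (n - 1)) (l : ℝ) :
    emb n (Rf e l y) = Rf (emb n e) l (emb n y) := by
  simp only [Rf, emb_lin, emb_inner n hn]

lemma lastCoord_eq (n : ℕ) (hn : 2 ≤ n) (x : Eu n) : lastCoord n x = x ⟨n - 1, by omega⟩ := by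
  unfold lastCoord
  rw [dif_pos (by omega)]

lemma lastCoord_emb (n : ℕ) (hn : 2 ≤ n) (y : Eu (n - 1)) : lastCoord n (emb n y) = 0 := by
  rw [lastCoord_eq n hn, emb_apply]; simp

lemma lastCoord_lin (n : ℕ) (hn : 2 ≤ n) (x e : Eu n) (r : ℝ) :
    lastCoord n (x + r • e) = lastCoord n x + r * lastCoord n e := by
  simp [lastCoord_eq n hn]

lemma lastCoord_xo (n : ℕ) (hn : 2 ≤ n) : lastCoord n (xo n) = -2 := by
  rw [lastCoord_eq n hn, xo_apply]; simp

lemma lastCoord_cont (n : ℕ) (hn : 2 ≤ n) : Continuous (lastCoord n) := by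
  have : lastCoord n = fun x => x ⟨n - 1, by omega⟩ := funext (lastCoord_eq n hn)
  rw [this]; fun_prop

lemma exists_emb (n : ℕ) (hn : 2 ≤ n) (e : Eu n) (he : lastCoord n e = 0) :
    ∃ e', emb n e' = e := by
  refine ⟨WithLp.toLp 2 fun i => e ⟨i, by omega⟩, ?_⟩
  ext i
  rw [emb_apply]
  split_ifs with h
  · rfl
  · rw [lastCoord_eq n hn] at he
    have hi : i = ⟨n - 1, by omega⟩ := Fin.ext (by have := i.2; simp only; omega)
    rw [hi]; exact he.symm

lemma inner_emb_xo (n : ℕ) (hn : 2 ≤ n) (a : Eu (n - 1)) : inner ℝ (emb n a) (xo n) = 0 := by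
  simp only [PiLp.inner_apply, emb_apply, xo_apply]
  refine Finset.sum_eq_zero fun i _ => ?_
  split_ifs with h1 h2
  · omega
  · simp
  · simp
  · simp

lemma upperHalf_open (n : ℕ) (hn : 2 ≤ n) : IsOpen (upperHalf n) :=
  isOpen_lt continuous_const (lastCoord_cont n hn)


/-- The interior measure. -/
def muH (n : ℕ) : Measure (Eu n) := (volume : Measure (Eu n)).restrict (upperHalf n)

/-- The boundary measure. -/
def nuB (n : ℕ) : Measure (Eu n) := Measure.map (emb n) volume

lemma muH_ae (n : ℕ) (hn : 2 ≤ n) : ∀ᵐ x ∂muH n, x ∈ upperHalf n :=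
  ae_restrict_mem (upperHalf_open n hn).measurableSet

lemma nuB_ae (n : ℕ) (hn : 2 ≤ n) : ∀ᵐ x ∂nuB n, lastCoord n x = 0 := by
  rw [nuB, ae_map_iff (emb_cont n).measurable.aemeasurable
    (measurableSet_eq_fun (lastCoord_cont n hn).measurable measurable_const)]
  exact Eventually.of_forall fun y => lastCoord_emb n hn y

lemma lastCoord_Rf (n : ℕ) (hn : 2 ≤ n) {e : Eu n} (he : lastCoord n e = 0) (l : ℝ) (x : Eu n) :
    lastCoord n (Rf e l x) = lastCoord n x := by
  rw [Rf, lastCoord_lin n hn, he]; simp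

lemma muH_inv (n : ℕ) (hn : 2 ≤ n) {e : Eu n} (h1 : ‖e‖ = 1) (he : lastCoord n e = 0) (l : ℝ) :
    MeasurePreserving (Rf e l) (muH n) (muH n) := by
  have h := (Rf_vol h1 l).restrict_preimage (upperHalf_open n hn).measurableSet
  have h2 : Rf e l ⁻¹' upperHalf n = upperHalf n := by
    ext x
    simp only [upperHalf, mem_preimage, mem_setOf_eq, lastCoord_Rf n hn he]
  rw [h2] at h
  exact h

lemma nuB_inv (n : ℕ) (hn : 2 ≤ n) {e : Eu (n - 1)} (h1 : ‖e‖ = 1) (l : ℝ) :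
    MeasurePreserving (Rf (emb n e) l) (nuB n) (nuB n) := by
  refine ⟨(Rf_continuous _ _).measurable, ?_⟩
  rw [nuB, Measure.map_map (Rf_continuous _ _).measurable (emb_cont n).measurable]
  have : Rf (emb n e) l ∘ emb n = emb n ∘ Rf e l := funext fun y => (emb_Rf n hn e y l).symm
  rw [this, ← Measure.map_map (emb_cont n).measurable (Rf_continuous _ _).measurable,
    (Rf_vol h1 l).map_eq]

lemma muH_null (n : ℕ) {e : Eu n} (h1 : ‖e‖ = 1) (l : ℝ) :
    muH n {x | inner ℝ e x = l} = 0 :=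
  Measure.absolutelyContinuous_of_le Measure.restrict_le_self (null_vol h1 l)

lemma nuB_null (n : ℕ) (hn : 2 ≤ n) {e : Eu (n - 1)} (h1 : ‖e‖ = 1) (l : ℝ) :
    nuB n {x | inner ℝ (emb n e) x = l} = 0 := by
  rw [nuB, Measure.map_apply (emb_cont n).measurable
    (measurableSet_eq_fun (by fun_prop) measurable_const)]
  simp only [preimage_setOf_eq, emb_inner n hn]
  exact null_vol h1 l

lemma muH_pos (n : ℕ) (hn : 2 ≤ n) {e : Eu (n - 1)} (h1 : ‖e‖ = 1) (l : ℝ) :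
    muH n {x | l < inner ℝ (emb n e) x} ≠ 0 := by
  rw [muH, Measure.restrict_apply' (upperHalf_open n hn).measurableSet]
  refine (((isOpen_lt continuous_const (by fun_prop)).inter (upperHalf_open n hn)).measure_pos
    volume ⟨(-1 : ℝ) • xo n + (l + 1) • emb n e, ?_, ?_⟩).ne'
  · simp only [mem_setOf_eq, inner_add_right, real_inner_smul_right, inner_emb_xo n hn,
      emb_inner n hn, real_inner_self_eq_norm_sq, h1]
    linarith
  · simp only [upperHalf, mem_setOf_eq]
    have h := lastCoord_lin n hn 0 (xo n) (-1)
    have h0 : lastCoord n 0 = 0 := by rw [lastCoord_eq n hn]; rfl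
    rw [zero_add] at h
    rw [lastCoord_lin n hn, lastCoord_emb n hn, h, h0, lastCoord_xo n hn]
    norm_num

lemma nuB_pos (n : ℕ) (hn : 2 ≤ n) {e : Eu (n - 1)} (h1 : ‖e‖ = 1) (l : ℝ) :
    nuB n {x | l < inner ℝ (emb n e) x} ≠ 0 := by
  rw [nuB, Measure.map_apply (emb_cont n).measurable
    (isOpen_lt continuous_const (by fun_prop)).measurableSet]
  simp only [preimage_setOf_eq, emb_inner n hn]
  refine ((isOpen_lt continuous_const (by fun_prop)).measure_pos
    volume ⟨(l + 1) • e, ?_⟩).ne'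
  simp only [mem_setOf_eq, real_inner_smul_right, real_inner_self_eq_norm_sq, h1]
  linarith

lemma ne_xo (n : ℕ) (hn : 2 ≤ n) {x : Eu n} (h : 0 ≤ lastCoord n x) : 0 < ‖x - xo n‖ := by
  refine norm_pos_iff.2 (sub_ne_zero.2 ?_)
  rintro rfl
  rw [lastCoord_xo n hn] at h
  norm_num at h

lemma w_lt (n : ℕ) (hn : 2 ≤ n) {s : ℝ} (hs : 0 < s) {e : Eu (n - 1)} (h1 : ‖e‖ = 1) {l : ℝ}
    (hl : 0 < l) {x : Eu n} (hx : 0 ≤ lastCoord n x) (hlx : l < inner ℝ (emb n e) x) :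
    ‖x - xo n‖ ^ (-s) < ‖Rf (emb n e) l x - xo n‖ ^ (-s) := by
  refine Real.rpow_lt_rpow_of_neg (ne_xo n hn ?_) ?_ (neg_lt_zero.2 hs)
  · rw [lastCoord_Rf n hn (lastCoord_emb n hn e)]; exact hx
  · exact Rf_lt (by rw [emb_norm n hn, h1]) hlx (by rw [inner_emb_xo n hn]; exact hl)

lemma Half_mu (n : ℕ) (hn : 2 ≤ n) {s b k : ℝ} (hs : 0 < s) (hb : 0 < b) (hk : k < 0)
    {v u : Eu n → ℝ} (vm : Measurable v) (v0 : ∀ x, 0 < v x)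
    (int : Integrable (fun x => v x ^ k * ‖x - xo n‖ ^ (-s) * (1 + ‖x‖) ^ b) (muH n))
    (rep : ∀ y, u y = ∫ x, v x ^ k * ‖x - xo n‖ ^ (-s) * ‖x - y‖ ^ b ∂muH n)
    {e : Eu (n - 1)} (h1 : ‖e‖ = 1) :
    Half (emb n e) b (muH n) (fun x => ‖x - xo n‖ ^ (-s)) k v u where
  he := by rw [emb_norm n hn, h1]
  hb := hb
  hk := hk
  inv := muH_inv n hn (by rw [emb_norm n hn, h1]) (lastCoord_emb n hn e)
  null := muH_null n (by rw [emb_norm n hn, h1])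
  pos := muH_pos n hn h1
  wm := by fun_prop
  w0 := fun x => by positivity
  wpos := by
    filter_upwards [muH_ae n hn] with x hx
    exact Real.rpow_pos_of_pos (ne_xo n hn (le_of_lt hx)) _
  wlt := fun l hl => by
    filter_upwards [muH_ae n hn] with x hx hlx
    exact w_lt n hn hs h1 hl (le_of_lt hx) hlx
  vm := vm
  v0 := v0
  int := int
  rep := rep

lemma Half_nu (n : ℕ) (hn : 2 ≤ n) {s b k : ℝ} (hs : 0 < s) (hb : 0 < b) (hk : k < 0)
    {v u : Eu n → ℝ} (vm : Measurable v) (v0 : ∀ x, 0 < v x)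
    (int : Integrable (fun x => v x ^ k * ‖x - xo n‖ ^ (-s) * (1 + ‖x‖) ^ b) (nuB n))
    (rep : ∀ y, u y = ∫ x, v x ^ k * ‖x - xo n‖ ^ (-s) * ‖x - y‖ ^ b ∂nuB n)
    {e : Eu (n - 1)} (h1 : ‖e‖ = 1) :
    Half (emb n e) b (nuB n) (fun x => ‖x - xo n‖ ^ (-s)) k v u where
  he := by rw [emb_norm n hn, h1]
  hb := hb
  hk := hk
  inv := nuB_inv n hn h1
  null := nuB_null n hn h1
  pos := nuB_pos n hn h1
  wm := by fun_prop
  w0 := fun x => by positivity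
  wpos := by
    filter_upwards [nuB_ae n hn] with x hx
    exact Real.rpow_pos_of_pos (ne_xo n hn hx.ge) _
  wlt := fun l hl => by
    filter_upwards [nuB_ae n hn] with x hx hlx
    exact w_lt n hn hs h1 hl hx.ge hlx
  vm := vm
  v0 := v0
  int := int
  rep := rep

lemma sing_of_null (n : ℕ) {μ : Measure (Eu n)} {e : Eu n}
    (h : ∀ l, μ {x | inner ℝ e x = l} = 0) (y : Eu n) : μ {y} = 0 :=
  measure_mono_null (by rintro x rfl; rfl) (h (inner ℝ e y))

lemma univ_of_pos (n : ℕ) {μ : Measure (Eu n)} {e : Eu n}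
    (h : ∀ l, μ {x | l < inner ℝ e x} ≠ 0) : μ univ ≠ 0 :=
  fun h0 => h 0 (measure_mono_null (subset_univ _) h0)

lemma exists_unit (n : ℕ) (hn : 2 ≤ n) : ∃ e : Eu (n - 1), ‖e‖ = 1 :=
  ⟨EuclideanSpace.single ⟨0, by omega⟩ 1, by simp⟩

set_option maxHeartbeats 1000000 in
lemma main_aux (n : ℕ) (hn : 2 ≤ n) {b κ θ s₁ s₂ : ℝ} (hb : 0 < b) (hκ : κ < 0) (hθ : θ < 0)
    (hs₁ : 0 < s₁) (hs₂ : 0 < s₂)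
    (u : Eu (n - 1) → ℝ) (v : Eu n → ℝ) (hvm : Measurable v)
    (hu0 : ∀ y, 0 < u y) (hv0 : ∀ x ∈ upperHalf n, 0 < v x)
    (hu : ∀ y, ENNReal.ofReal (u y) =
      ∫⁻ x in upperHalf n,
        ENNReal.ofReal (v x ^ κ * ‖x - emb n y‖ ^ b * ‖x - xo n‖ ^ (-s₂)))
    (hv : ∀ x ∈ upperHalf n, ENNReal.ofReal (v x) =
      ∫⁻ y, ENNReal.ofReal (u y ^ θ * ‖x - emb n y‖ ^ b * ‖emb n y - xo n‖ ^ (-s₁))) :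
    ∃ U V : Eu n → ℝ, (∀ y, U (emb n y) = u y) ∧ (∀ x ∈ upperHalf n, V x = v x) ∧
      ∀ e : Eu (n - 1), ‖e‖ = 1 → PP (emb n e) 0 U ∧ PP (emb n e) 0 V := by
  obtain ⟨e0, he0⟩ := exists_unit n hn
  have he0n : emb n e0 ≠ 0 := by
    intro h
    have := emb_norm n hn e0
    rw [h, he0] at this
    simp at this
  have hUm := (upperHalf_open n hn).measurableSet
  -- the interior density
  set g : Eu n → ℝ := fun x => |v x| ^ κ * ‖x - xo n‖ ^ (-s₂) with hg
  have gm : Measurable g := by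
    have : Measurable fun x => |v x| := by fun_prop
    fun_prop
  have g0 : ∀ x, 0 ≤ g x := fun x => by positivity
  have gp : ∀ᵐ x ∂muH n, 0 < g x := by
    filter_upwards [muH_ae n hn] with x hx
    have h1 := hv0 x hx
    exact mul_pos (Real.rpow_pos_of_pos (abs_pos.2 h1.ne') _)
      (Real.rpow_pos_of_pos (ne_xo n hn (le_of_lt hx)) _)
  have hu1 : ∀ y, ENNReal.ofReal (u y) =
      ∫⁻ x, ENNReal.ofReal (g x * ‖x - emb n y‖ ^ b) ∂muH n := by
    intro y
    rw [hu y]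
    refine setLIntegral_congr_fun hUm fun x hx => ?_
    simp only [hg]
    rw [abs_of_pos (hv0 x hx)]
    congr 1
    ring
  have gi : Integrable (fun x => g x * (1 + ‖x‖) ^ b) (muH n) := by
    refine int_of_two g0 gm hb (y₁ := emb n 0) (y₂ := emb n e0) ?_ ?_ ?_
    · intro h
      have h1 := emb_norm n hn 0
      rw [h, emb_norm n hn, he0] at h1
      simp at h1
    · rw [← hu1]; exact ENNReal.ofReal_ne_top
    · rw [← hu1]; exact ENNReal.ofReal_ne_top
  obtain ⟨U, hU⟩ : ∃ U : Eu n → ℝ, U = fun z => ∫ x, g x * ‖x - z‖ ^ b ∂muH n := ⟨_, rfl⟩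
  have Uc : Continuous U := by
    rw [hU]; exact cont_gen g0 gm hb gi
  have U0 : ∀ z, 0 < U z := by
    rw [hU]
    exact pos_gen g0 gp gm hb gi (univ_of_pos n (muH_pos n hn he0))
      (sing_of_null n (muH_null n (e := emb n e0) (by rw [emb_norm n hn, he0])))
  have Uu : ∀ y, U (emb n y) = u y := fun y => by
    rw [hU]
    exact (rep_gen g0 gm hb gi (emb n y) (hu0 y) (hu1 y)).symm
  -- the boundary density
  set f : Eu n → ℝ := fun x => U x ^ θ * ‖x - xo n‖ ^ (-s₁) with hf
  have fm : Measurable f := by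
    have := Uc.measurable
    fun_prop
  have f0 : ∀ x, 0 ≤ f x := fun x => by
    exact mul_nonneg (Real.rpow_nonneg (U0 x).le _) (Real.rpow_nonneg (norm_nonneg _) _)
  have fp : ∀ᵐ x ∂nuB n, 0 < f x := by
    filter_upwards [nuB_ae n hn] with x hx
    exact mul_pos (Real.rpow_pos_of_pos (U0 x) _) (Real.rpow_pos_of_pos (ne_xo n hn hx.ge) _)
  have hv1 : ∀ x ∈ upperHalf n, ENNReal.ofReal (v x) =
      ∫⁻ y, ENNReal.ofReal (f y * ‖y - x‖ ^ b) ∂nuB n := by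
    intro x hx
    have hm : Measurable fun y => ENNReal.ofReal (f y * ‖y - x‖ ^ b) := by fun_prop
    rw [hv x hx, nuB, lintegral_map hm (emb_cont n).measurable]
    refine lintegral_congr fun y => ?_
    simp only [hf]
    rw [Uu, norm_sub_rev x]
    congr 1
    ring
  have hx1 : lastCoord n ((-1 : ℝ) • xo n) = 2 := by
    have h := lastCoord_lin n hn 0 (xo n) (-1)
    have h0 : lastCoord n 0 = 0 := by rw [lastCoord_eq n hn]; rfl
    rw [zero_add, h0, lastCoord_xo n hn] at h
    rw [h]; norm_num
  have fi : Integrable (fun x => f x * (1 + ‖x‖) ^ b) (nuB n) := by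
    have m1 : (-1 : ℝ) • xo n ∈ upperHalf n := by
      change 0 < lastCoord n _
      rw [hx1]; norm_num
    have m2 : (-1 : ℝ) • xo n + (1 : ℝ) • emb n e0 ∈ upperHalf n := by
      change 0 < lastCoord n _
      rw [lastCoord_lin n hn, hx1, lastCoord_emb n hn]; norm_num
    refine int_of_two f0 fm hb (y₁ := (-1 : ℝ) • xo n)
      (y₂ := (-1 : ℝ) • xo n + (1 : ℝ) • emb n e0) ?_ ?_ ?_
    · intro h
      rw [one_smul, left_eq_add] at h
      exact he0n h
    · rw [← hv1 _ m1]; exact ENNReal.ofReal_ne_top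
    · rw [← hv1 _ m2]; exact ENNReal.ofReal_ne_top
  obtain ⟨V, hV⟩ : ∃ V : Eu n → ℝ, V = fun z => ∫ x, f x * ‖x - z‖ ^ b ∂nuB n := ⟨_, rfl⟩
  have Vc : Continuous V := by
    rw [hV]; exact cont_gen f0 fm hb fi
  have V0 : ∀ z, 0 < V z := by
    rw [hV]
    exact pos_gen f0 fp fm hb fi (univ_of_pos n (nuB_pos n hn he0))
      (sing_of_null n (nuB_null n hn he0))
  have Vv : ∀ x ∈ upperHalf n, V x = v x := fun x hx => by
    rw [hV]
    exact (rep_gen f0 fm hb fi x (hv0 x hx) (hv1 x hx)).symm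
  have hgV : ∀ᵐ x ∂muH n, g x = V x ^ κ * ‖x - xo n‖ ^ (-s₂) := by
    filter_upwards [muH_ae n hn] with x hx
    simp only [hg]
    rw [Vv x hx, abs_of_pos (hv0 x hx)]
  refine ⟨U, V, Uu, Vv, fun e he => ?_⟩
  have H2 : Half (emb n e) b (nuB n) (fun x => ‖x - xo n‖ ^ (-s₁)) θ U V :=
    Half_nu n hn hs₁ hb hθ Uc.measurable U0 fi (fun y => by rw [hV]) he
  have H1 : Half (emb n e) b (muH n) (fun x => ‖x - xo n‖ ^ (-s₂)) κ V U := by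
    refine Half_mu n hn hs₂ hb hκ Vc.measurable V0 (gi.congr ?_) (fun y => ?_) he
    · filter_upwards [hgV] with x hx
      rw [hx]
    · rw [hU]
      refine integral_congr_ae ?_
      filter_upwards [hgV] with x hx
      rw [hx]
  exact moving H1 H2

lemma sym_of_PP (n : ℕ) (hn : 2 ≤ n) {U : Eu n → ℝ}
    (h : ∀ e : Eu (n - 1), ‖e‖ = 1 → PP (emb n e) 0 U) {x z : Eu n} (hxz : ‖x‖ = ‖z‖)
    (hl : lastCoord n x = lastCoord n z) : U z ≤ U x := by
  by_cases hne : x = z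
  · rw [hne]
  obtain ⟨h1, h2, h3⟩ := Rf_swap hxz hne
  have h4 : lastCoord n (‖x - z‖⁻¹ • (x - z)) = 0 := by
    rw [lastCoord_eq n hn] at hl ⊢
    rw [lastCoord_eq n hn] at hl
    simp [hl]
  obtain ⟨e, he⟩ := exists_emb n hn _ h4
  rw [← he] at h1 h2 h3
  rw [emb_norm n hn] at h1
  have := h e h1 x h3
  rwa [h2] at this

end Concrete

/-- Proposition 2.9, symmetry with respect to the `x_n`-axis
of positive solutions of the integral system on the upper half space. -/
theorem system_solutions_axially_symmetric
    (n : ℕ) (hn : 2 ≤ n) (α : ℝ) (hα : (n : ℝ) < α)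
    (p t t' θ κ s₁ s₂ s₁' s₂' : ℝ)
    (hp0 : 0 < p) (hp : p < 2 * ((n : ℝ) - 1) / ((n : ℝ) + α - 2))
    (ht0 : 0 < t) (ht : t < 2 * (n : ℝ) / ((n : ℝ) + α))
    (ht' : t' = t / (t - 1))
    (hθ : θ = 1 / (p - 1)) (hκ : κ = t' - 1)
    (hs₁ : s₁ = (n : ℝ) + α - 2 - ((n : ℝ) - α) / (p - 1))
    (hs₂ : s₂ = (α - (n : ℝ)) * t' + 2 * (n : ℝ))
    (hs₁' : s₁' = (n : ℝ) + α - 2 - 2 * ((n : ℝ) - 1) / p)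
    (hs₂' : s₂' = (n : ℝ) + α - 2 * (n : ℝ) / t)
    (u : Eu (n - 1) → ℝ) (v : Eu n → ℝ)
    (hum : Measurable u) (hvm : Measurable v)
    (hu0 : ∀ y, 0 < u y) (hv0 : ∀ x ∈ upperHalf n, 0 < v x)
    (hu : ∀ y, ENNReal.ofReal (u y) =
      ∫⁻ x in upperHalf n,
        ENNReal.ofReal (v x ^ κ * ‖x - emb n y‖ ^ (α - (n : ℝ)) * ‖x - xo n‖ ^ (-s₂)))
    (hv : ∀ x ∈ upperHalf n, ENNReal.ofReal (v x) =
      ∫⁻ y, ENNReal.ofReal (u y ^ θ * ‖x - emb n y‖ ^ (α - (n : ℝ)) * ‖emb n y - xo n‖ ^ (-s₁)))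
    (huL : (∫⁻ y, ENNReal.ofReal ((u y * ‖emb n y - xo n‖ ^ (-s₁')) ^ (θ + 1))) ≠ ⊤)
    (hvL : (∫⁻ x in upperHalf n, ENNReal.ofReal ((v x * ‖x - xo n‖ ^ (-s₂')) ^ t')) ≠ ⊤)
    :
    (∀ y z : Eu (n - 1), ‖y‖ = ‖z‖ → u y = u z) ∧
    (∀ x ∈ upperHalf n, ∀ z ∈ upperHalf n,
      ‖x‖ = ‖z‖ → lastCoord n x = lastCoord n z → v x = v z) := by

  have hn2 : (2 : ℝ) ≤ n := by exact_mod_cast hn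
  have hp1 : p < 1 := by
    refine hp.trans ?_
    rw [div_lt_one (by linarith)]
    linarith
  have ht1 : t < 1 := by
    refine ht.trans ?_
    rw [div_lt_one (by linarith)]
    linarith
  have hθ0 : θ < 0 := by
    rw [hθ]
    exact div_neg_of_pos_of_neg one_pos (by linarith)
  have hκ0 : κ < 0 := by
    rw [hκ, ht']
    have : t / (t - 1) < 0 := div_neg_of_pos_of_neg ht0 (by linarith)
    linarith
  have hs₁0 : 0 < s₁ := by
    rw [lt_div_iff₀ (by linarith)] at hp
    have h1 : s₁ = (2 * ((n : ℝ) - 1) - p * (n + α - 2)) / (1 - p) := by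
      have h2 : p - 1 ≠ 0 := by linarith
      have h3 : 1 - p ≠ 0 := by linarith
      rw [hs₁, ← neg_sub 1 p, div_neg]
      field_simp
      ring
    rw [h1]
    exact div_pos (by linarith) (by linarith)
  have hs₂0 : 0 < s₂ := by
    rw [lt_div_iff₀ (by linarith)] at ht
    have h1 : s₂ = (2 * (n : ℝ) - t * (n + α)) / (1 - t) := by
      have h3 : 1 - t ≠ 0 := by linarith
      rw [hs₂, ht', ← neg_sub 1 t, div_neg]
      field_simp
      ring
    rw [h1]
    exact div_pos (by linarith) (by linarith)
  obtain ⟨U, V, hU, hV, hPP⟩ := main_aux n hn (b := α - (n : ℝ)) (by linarith) hκ0 hθ0 hs₁0 hs₂0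
    u v hvm hu0 hv0 hu hv
  refine ⟨fun y z hyz => ?_, fun x hx z hz hxz hl => ?_⟩
  · rw [← hU, ← hU]
    have h1 : ‖emb n y‖ = ‖emb n z‖ := by rw [emb_norm n hn, emb_norm n hn, hyz]
    have h2 : lastCoord n (emb n y) = lastCoord n (emb n z) := by
      rw [lastCoord_emb n hn, lastCoord_emb n hn]
    exact le_antisymm (sym_of_PP n hn (fun e he => (hPP e he).1) h1.symm h2.symm)
      (sym_of_PP n hn (fun e he => (hPP e he).1) h1 h2)
  · rw [← hV x hx, ← hV z hz]
    exact le_antisymm (sym_of_PP n hn (fun e he => (hPP e he).2) hxz.symm hl.symm)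
      (sym_of_PP n hn (fun e he => (hPP e he).2) hxz hl)
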